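/- Let (G,+) be a finite Abelian group with |G| = q whose only characteristic subgroups are {0} and G. Then every generalized q-symmetric channel W : G → 𝒴 satisfying the background polarization property strongly polarizes: for every δ > 0, lim_{n→∞} 2^{−n}·|{s ∈ {−,+}ⁿ : W^s is δ-determined by {0} or W^s is δ-determined by G}| = 1. -/

import Mathlib

open scoped Classical

noncomputable section

universe u v

/-- A (discrete memoryless) channel with input alphabet `X` and finite output alphabet `Y`:
nonnegative entries and each row sums to `1`. -/
def IsChannel {X : Type*} {Y : Type*} [Fintype Y] (W : X → Y → ℝ) : Prop :=
  (∀ x y, 0 ≤ W x y) ∧ ∀ x, ∑ y, W x y = 1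

/-- The symmetric capacity of a channel: the mutual information between a uniformly
distributed input and the corresponding output (terms with `W x y = 0` vanish). -/
def capacity {X : Type*} {Y : Type*} [Fintype X] [Fintype Y] (W : X → Y → ℝ) : ℝ :=
  ∑ y : Y, ∑ x : X, (1 / (Fintype.card X : ℝ)) * W x y *
    Real.log (W x y / ((1 / (Fintype.card X : ℝ)) * ∑ x' : X, W x' y))

/-- The quotient channel `W[H] : G ⧸ H → Y`, `W[H](y|A) = (1/|H|) ∑_{x ∈ A} W(y|x)`. -/
def quotientChannel {G : Type*} [AddCommGroup G] [Fintype G] (H : AddSubgroup G)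
    {Y : Type*} (W : G → Y → ℝ) : G ⧸ H → Y → ℝ :=
  fun A y => (1 / (Nat.card H : ℝ)) * ∑ x : G, if (x : G ⧸ H) = A then W x y else 0

/-- `W` is `δ`-determined by the subgroup `H`:
`|I(W) − log|G/H|| < δ` and `|I(W[H]) − log|G/H|| < δ`. -/
def DeterminedBy {G : Type*} [AddCommGroup G] [Fintype G] {Y : Type*} [Fintype Y]
    (W : G → Y → ℝ) (H : AddSubgroup G) (δ : ℝ) : Prop :=
  |capacity W - Real.log (Nat.card (G ⧸ H))| < δ ∧
  |capacity (quotientChannel H W) - Real.log (Nat.card (G ⧸ H))| < δ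

/-- The "minus" Arıkan transform `W⁻(y₁,y₂|u₁) = (1/q) ∑_{u₂} W(y₁|u₁+u₂) W(y₂|u₂)`. -/
def minusChannel {G : Type*} [AddCommGroup G] [Fintype G] {Y : Type*}
    (W : G → Y → ℝ) : G → Y × Y → ℝ :=
  fun u₁ y => (1 / (Fintype.card G : ℝ)) * ∑ u₂ : G, W (u₁ + u₂) y.1 * W u₂ y.2

/-- The "plus" Arıkan transform `W⁺(y₁,y₂,u₁|u₂) = (1/q) W(y₁|u₁+u₂) W(y₂|u₂)`;
the output `(y₁, y₂, u₁)` is encoded as `((y₁, y₂), u₁)`. -/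
def plusChannel {G : Type*} [AddCommGroup G] [Fintype G] {Y : Type*}
    (W : G → Y → ℝ) : G → (Y × Y) × G → ℝ :=
  fun u₂ z => (1 / (Fintype.card G : ℝ)) * W (z.2 + u₂) z.1.1 * W u₂ z.1.2

/-- `W` is degraded from `W'`: `W` is obtained from `W'` by composing with a channel `V`. -/
def DegradedFrom {X : Type*} {Y Y' : Type*} [Fintype Y] [Fintype Y'] (W : X → Y → ℝ)
    (W' : X → Y' → ℝ) : Prop :=
  ∃ V : Y' → Y → ℝ, IsChannel V ∧ ∀ x y, W x y = ∑ y' : Y', W' x y' * V y' y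

/-- Channel equivalence: mutual degradation. -/
def EquivalentChannels {X : Type*} {Y Y' : Type*} [Fintype Y] [Fintype Y'] (W : X → Y → ℝ)
    (W' : X → Y' → ℝ) : Prop :=
  DegradedFrom W W' ∧ DegradedFrom W' W

/-- The erasure channel of input alphabet `A` and parameter `ε`; the output alphabet is
`A ∪ {e}`, modelled as `Option A` with `none` as the erasure symbol `e`. For `A = G` this is
the `q`-ary erasure channel `qEC(ε)`. -/
def erasureChannel (A : Type*) (ε : ℝ) : A → Option A → ℝ :=
  fun x y => match y with
    | some z => if z = x then 1 - ε else 0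
    | none => ε

/-- `W : G → Y → ℝ` is a generalized `q`-symmetric channel. -/
def IsGeneralizedSymmetric {G : Type u} [Fintype G] {Y : Type v} [Fintype Y]
    (W : G → Y → ℝ) : Prop :=
  ∃ (Z : Type v) (_ : Fintype Z) (π : G × Z ≃ Y) (p : Z → ℝ) (ε : Z → ℝ),
    (∀ z, 0 ≤ p z) ∧ (∑ z, p z = 1) ∧
    (∀ z, 0 ≤ ε z) ∧ (∀ z, ε z ≤ 1 / ((Fintype.card G : ℝ) - 1)) ∧
    ∀ x x' z, W x (π (x', z)) =
      if x' = x then p z * (1 - ((Fintype.card G : ℝ) - 1) * ε z) else p z * ε z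

/-- `W` is automorphic-symmetric with respect to `(G,+)`: for every automorphism `f` of `G`
there is a bijection `π_f` of the output alphabet with `W(π_f(y)|f(x)) = W(y|x)`. -/
def IsAutSymmetric {G : Type*} [AddCommGroup G] {Y : Type*} (W : G → Y → ℝ) : Prop :=
  ∀ f : G ≃+ G, ∃ π : Y ≃ Y, ∀ x y, W (f x) (π y) = W x y

/-- A channel with input alphabet `G`, packaged with its (finite) output alphabet. -/
structure Channel (G : Type u) where
  Out : Type u
  [fin : Fintype Out]
  prob : G → Out → ℝ

attribute [instance] Channel.fin

def Channel.minus {G : Type u} [AddCommGroup G] [Fintype G] (C : Channel G) : Channel G :=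
  ⟨C.Out × C.Out, minusChannel C.prob⟩

def Channel.plus {G : Type u} [AddCommGroup G] [Fintype G] (C : Channel G) : Channel G :=
  ⟨(C.Out × C.Out) × G, plusChannel C.prob⟩

/-- `C.polar s` is the synthetic channel `W^s`, where `false` encodes `-`, `true` encodes `+`,
and the head of the list is the first transform applied. -/
def Channel.polar {G : Type u} [AddCommGroup G] [Fintype G] (C : Channel G) :
    List Bool → Channel G
  | [] => C
  | b :: s => (cond b C.plus C.minus).polar s

/-- `C` `𝓗`-polarizes: for every `δ > 0`, the fraction of `s ∈ {−,+}ⁿ` such that `W^s` is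
`δ`-determined by some subgroup in `𝓗` tends to `1` as `n → ∞`. Taking `𝓗` to be the set of
all subgroups gives the background (multilevel) polarization property. -/
def Polarizes {G : Type u} [AddCommGroup G] [Fintype G] (C : Channel G)
    (𝓗 : Set (AddSubgroup G)) : Prop :=
  ∀ δ > (0 : ℝ), Filter.Tendsto
    (fun n : ℕ => ((Finset.univ.filter (fun s : Fin n → Bool =>
        ∃ H ∈ 𝓗, DeterminedBy (C.polar (List.ofFn s)).prob H δ)).card : ℝ) / 2 ^ n)
    Filter.atTop (nhds 1)

theorem IsGeneralizedSymmetric.isAutSymmetric {G : Type*} [AddCommGroup G] [Fintype G]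
    {Y : Type*} [Fintype Y] {W : G → Y → ℝ} (h : IsGeneralizedSymmetric W) :
    IsAutSymmetric W := by
  obtain ⟨Z, _, π, p, ε, -, -, -, -, hW⟩ := h
  intro f
  refine ⟨π.symm.trans ((f.toEquiv.prodCongr (Equiv.refl Z)).trans π), fun x y => ?_⟩
  obtain ⟨⟨x', z⟩, rfl⟩ := π.surjective y
  simp [hW]

theorem IsAutSymmetric.minusChannel {G : Type*} [AddCommGroup G] [Fintype G] {Y : Type*}
    {W : G → Y → ℝ} (h : IsAutSymmetric W) : IsAutSymmetric (minusChannel W) := by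
  intro f
  obtain ⟨π, hπ⟩ := h f
  refine ⟨π.prodCongr π, fun u y => ?_⟩
  simp only [_root_.minusChannel, Equiv.prodCongr_apply, Prod.map_fst, Prod.map_snd]
  rw [← Equiv.sum_comp f.toEquiv]
  simp [← map_add, hπ]

theorem IsAutSymmetric.plusChannel {G : Type*} [AddCommGroup G] [Fintype G] {Y : Type*}
    {W : G → Y → ℝ} (h : IsAutSymmetric W) : IsAutSymmetric (plusChannel W) := by
  intro f
  obtain ⟨π, hπ⟩ := h f
  refine ⟨(π.prodCongr π).prodCongr f.toEquiv, fun u y => ?_⟩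
  simp [_root_.plusChannel, ← map_add, hπ]

theorem IsChannel.minusChannel {G : Type*} [AddCommGroup G] [Fintype G] {Y : Type*} [Fintype Y]
    {W : G → Y → ℝ} (h : IsChannel W) : IsChannel (minusChannel W) := by
  refine ⟨fun x y => mul_nonneg (by positivity)
    (Finset.sum_nonneg fun u _ => mul_nonneg (h.1 _ _) (h.1 _ _)), fun x => ?_⟩
  simp only [_root_.minusChannel]
  rw [← Finset.mul_sum, Finset.sum_comm]
  simp [Fintype.sum_prod_type, ← Finset.mul_sum, h.2]

theorem IsChannel.plusChannel {G : Type*} [AddCommGroup G] [Fintype G] {Y : Type*} [Fintype Y]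
    {W : G → Y → ℝ} (h : IsChannel W) : IsChannel (plusChannel W) := by
  refine ⟨fun x y => mul_nonneg (mul_nonneg (by positivity) (h.1 _ _)) (h.1 _ _), fun x => ?_⟩
  simp only [_root_.plusChannel]
  rw [Fintype.sum_prod_type, Finset.sum_comm]
  simp [Fintype.sum_prod_type, mul_assoc, ← Finset.mul_sum, h.2]

theorem Channel.polar_induction {G : Type u} [AddCommGroup G] [Fintype G] {P : Channel G → Prop}
    (hminus : ∀ C, P C → P C.minus) (hplus : ∀ C, P C → P C.plus) (s : List Bool) :
    ∀ C : Channel G, P C → P (C.polar s) := by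
  induction s with
  | nil => exact fun C h => h
  | cons b s ih =>
    intro C h
    cases b
    · exact ih _ (hminus C h)
    · exact ih _ (hplus C h)

theorem AddSubgroup.natCard_quotient_mul_natCard {G : Type*} [AddCommGroup G] [Fintype G]
    (H : AddSubgroup G) :
    (Nat.card (G ⧸ H) : ℝ) * Nat.card H = Fintype.card G := by
  rw [← Nat.card_eq_fintype_card, H.card_eq_card_quotient_mul_card_addSubgroup]
  push_cast
  rfl

theorem capacity_quotientChannel {G : Type*} [AddCommGroup G] [Fintype G] (H : AddSubgroup G)
    {Y : Type*} [Fintype Y] (W : G → Y → ℝ) :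
    capacity (quotientChannel H W) = ∑ y, ∑ x : G, (1 / (Fintype.card G : ℝ)) * W x y *
      Real.log (quotientChannel H W x y / ((1 / (Fintype.card G : ℝ)) * ∑ x', W x' y)) := by
  have hcard := H.natCard_quotient_mul_natCard
  rw [Nat.card_eq_fintype_card (α := G ⧸ H)] at hcard
  refine Finset.sum_congr rfl fun y _ => ?_
  have hsum : ∑ A, quotientChannel H W A y = (1 / (Nat.card H : ℝ)) * ∑ x, W x y := by
    simp only [quotientChannel]
    rw [← Finset.mul_sum, Finset.sum_comm]
    simp
  have hprod : (1 / (Fintype.card (G ⧸ H) : ℝ)) * (1 / (Nat.card H : ℝ)) =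
      1 / (Fintype.card G : ℝ) := by
    rw [← hcard, one_div_mul_one_div]
  rw [hsum, ← mul_assoc, hprod]
  generalize hg : (fun A => Real.log (quotientChannel H W A y /
    ((1 / (Fintype.card G : ℝ)) * ∑ x', W x' y))) = g
  have hg' : ∀ A, Real.log (quotientChannel H W A y /
    ((1 / (Fintype.card G : ℝ)) * ∑ x', W x' y)) = g A := fun A => by rw [← hg]
  simp only [hg']
  simp only [quotientChannel, ← mul_assoc, hprod]
  simp only [Finset.mul_sum, Finset.sum_mul]
  rw [Finset.sum_comm]
  simp

theorem capacity_quotientChannel_map {G : Type*} [AddCommGroup G] [Fintype G]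
    (H : AddSubgroup G) (f : G ≃+ G) {Y : Type*} [Fintype Y] {W : G → Y → ℝ}
    (h : IsAutSymmetric W) :
    capacity (quotientChannel (H.map f.toAddMonoidHom) W) = capacity (quotientChannel H W) := by
  obtain ⟨π, hπ⟩ := h f
  have hmem : ∀ x x' : G, ((f x : G ⧸ H.map f.toAddMonoidHom) = f x') ↔ (x : G ⧸ H) = x' := by
    intro x x'
    rw [QuotientAddGroup.eq, QuotientAddGroup.eq, ← map_neg, ← map_add]
    exact AddSubgroup.mem_map_iff_mem f.injective
  have hcard : Nat.card (H.map f.toAddMonoidHom) = Nat.card H :=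
    (Nat.card_congr (H.equivMapOfInjective f.toAddMonoidHom f.injective).toEquiv).symm
  have hsum : ∀ y, ∑ x, W x (π y) = ∑ x, W x y := fun y => by
    rw [← Equiv.sum_comp f.toEquiv]
    exact Finset.sum_congr rfl fun x _ => hπ x y
  have hquot : ∀ x y, quotientChannel (H.map f.toAddMonoidHom) W (f x) (π y) =
      quotientChannel H W x y := by
    intro x y
    simp only [quotientChannel]
    rw [hcard, ← Equiv.sum_comp f.toEquiv]
    congr 1
    refine Finset.sum_congr rfl fun x' _ => ?_
    exact if_congr (hmem x' x) (hπ x' y) rfl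
  rw [capacity_quotientChannel, capacity_quotientChannel, ← Equiv.sum_comp π]
  refine Finset.sum_congr rfl fun y _ => ?_
  rw [← Equiv.sum_comp f.toEquiv]
  refine Finset.sum_congr rfl fun x _ => ?_
  simp only [AddEquiv.toEquiv_eq_coe, EquivLike.coe_coe]
  rw [hπ, hquot, hsum]

theorem card_filter_mk_eq_le {G : Type*} [AddCommGroup G] [Fintype G] (H K : AddSubgroup G)
    (a b : G) :
    (Finset.univ.filter fun x : G => (a : G ⧸ H) = x ∧ (b : G ⧸ K) = x).card ≤
      Nat.card (H ⊓ K : AddSubgroup G) := by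
  obtain hempty | ⟨x₀, hx₀⟩ := Finset.eq_empty_or_nonempty
    (Finset.univ.filter fun x : G => (a : G ⧸ H) = x ∧ (b : G ⧸ K) = x)
  · simp [hempty]
  rw [Finset.mem_filter] at hx₀
  rw [Nat.card_eq_fintype_card, ← Finset.card_univ]
  refine Finset.card_le_card_of_injOn
    (fun x => if hx : -x₀ + x ∈ H ⊓ K then ⟨-x₀ + x, hx⟩ else 0) (fun _ _ => Finset.mem_univ _) ?_
  have hmem : ∀ x ∈ Finset.univ.filter fun x : G => (a : G ⧸ H) = x ∧ (b : G ⧸ K) = x,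
      -x₀ + x ∈ H ⊓ K := by
    intro x hx
    rw [Finset.mem_filter] at hx
    exact ⟨QuotientAddGroup.eq.1 (hx₀.2.1.symm.trans hx.2.1),
      QuotientAddGroup.eq.1 (hx₀.2.2.symm.trans hx.2.2)⟩
  intro x hx x' hx' heq
  beta_reduce at heq
  rw [dif_pos (hmem x hx), dif_pos (hmem x' hx')] at heq
  exact add_left_cancel (congrArg Subtype.val heq)

theorem sum_quotientChannel_mul_le {G : Type*} [AddCommGroup G] [Fintype G]
    (H K : AddSubgroup G) {Y : Type*} {W : G → Y → ℝ} (h : ∀ x y, 0 ≤ W x y) (y : Y) :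
    ∑ x : G, quotientChannel H W x y * quotientChannel K W x y ≤
      Nat.card (H ⊓ K : AddSubgroup G) / (Nat.card H * Nat.card K) * (∑ x, W x y) ^ 2 := by
  have key : ∀ x : G, quotientChannel H W x y * quotientChannel K W x y =
      ∑ a : G, ∑ b : G, (1 / (Nat.card H * Nat.card K : ℝ)) * (W a y * W b y) *
        (if (a : G ⧸ H) = x ∧ (b : G ⧸ K) = x then 1 else 0) := by
    intro x
    simp only [quotientChannel]
    rw [mul_mul_mul_comm, Finset.sum_mul_sum, one_div_mul_one_div, Finset.mul_sum]
    refine Finset.sum_congr rfl fun a _ => ?_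
    rw [Finset.mul_sum]
    refine Finset.sum_congr rfl fun b _ => ?_
    by_cases h1 : (a : G ⧸ H) = x <;> by_cases h2 : (b : G ⧸ K) = x <;> simp [h1, h2]
  simp only [key]
  rw [Finset.sum_comm]
  calc ∑ a : G, ∑ x : G, ∑ b : G, (1 / (Nat.card H * Nat.card K : ℝ)) * (W a y * W b y) *
        (if (a : G ⧸ H) = x ∧ (b : G ⧸ K) = x then (1 : ℝ) else 0)
      ≤ ∑ a : G, ∑ b : G, (1 / (Nat.card H * Nat.card K : ℝ)) * (W a y * W b y) *
        Nat.card (H ⊓ K : AddSubgroup G) := by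
        refine Finset.sum_le_sum fun a _ => ?_
        rw [Finset.sum_comm]
        refine Finset.sum_le_sum fun b _ => ?_
        rw [← Finset.mul_sum, Finset.sum_boole]
        exact mul_le_mul_of_nonneg_left (mod_cast card_filter_mk_eq_le H K a b)
          (mul_nonneg (by positivity) (mul_nonneg (h _ _) (h _ _)))
    _ = _ := by
        simp only [← Finset.sum_mul, ← Finset.mul_sum]
        ring

theorem quotientChannel_nonneg {G : Type*} [AddCommGroup G] [Fintype G] (H : AddSubgroup G)
    {Y : Type*} {W : G → Y → ℝ} (h : ∀ x y, 0 ≤ W x y) (A : G ⧸ H) (y : Y) :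
    0 ≤ quotientChannel H W A y :=
  mul_nonneg (by positivity) (Finset.sum_nonneg fun x _ => by split_ifs <;> simp [h])

theorem quotientChannel_mk_pos {G : Type*} [AddCommGroup G] [Fintype G] (H : AddSubgroup G)
    {Y : Type*} {W : G → Y → ℝ} (h : ∀ x y, 0 ≤ W x y) {x : G} {y : Y} (hx : 0 < W x y) :
    0 < quotientChannel H W x y := by
  refine mul_pos (one_div_pos.2 (mod_cast Nat.card_pos)) ?_
  refine Finset.sum_pos' (fun x _ => by split_ifs <;> simp [h]) ⟨x, Finset.mem_univ x, ?_⟩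
  simpa using hx

/-- Knowing the input modulo `H` and modulo `K` determines it modulo `H ⊓ K`. -/
theorem capacity_quotientChannel_add_le {G : Type*} [AddCommGroup G] [Fintype G]
    (H K : AddSubgroup G) {Y : Type*} [Fintype Y] {W : G → Y → ℝ} (h : IsChannel W) :
    capacity (quotientChannel H W) + capacity (quotientChannel K W) ≤ capacity W +
      Real.log (Fintype.card G * Nat.card (H ⊓ K : AddSubgroup G) /
        (Nat.card H * Nat.card K)) := by
  set q : ℝ := (Fintype.card G : ℝ) with hq
  set c : ℝ := q * Nat.card (H ⊓ K : AddSubgroup G) / (Nat.card H * Nat.card K) with hc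
  have hq0 : 0 < q := by simp only [hq]; exact_mod_cast Fintype.card_pos
  have hH : 0 < (Nat.card H : ℝ) := mod_cast Nat.card_pos
  have hK : 0 < (Nat.card K : ℝ) := mod_cast Nat.card_pos
  have hHK : 0 < (Nat.card (H ⊓ K : AddSubgroup G) : ℝ) := mod_cast Nat.card_pos
  have hc0 : 0 < c := by positivity
  have hlog : Real.log c = ∑ y, ∑ x, (1 / q) * W x y * Real.log c := by
    rw [Finset.sum_comm]
    simp only [← Finset.sum_mul, ← Finset.mul_sum, h.2]
    simp [hq]
  rw [capacity_quotientChannel, capacity_quotientChannel, hlog, capacity,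
    ← Finset.sum_add_distrib, ← Finset.sum_add_distrib]
  refine Finset.sum_le_sum fun y _ => ?_
  rw [← Finset.sum_add_distrib, ← Finset.sum_add_distrib, ← sub_nonpos,
    ← Finset.sum_sub_distrib]
  rw [← hq]
  set S : ℝ := ∑ x, W x y with hS
  have hS0 : 0 ≤ S := Finset.sum_nonneg fun x _ => h.1 x y
  have hterm : ∀ x : G, (1 / q) * W x y * Real.log (quotientChannel H W x y / (1 / q * S)) +
      (1 / q) * W x y * Real.log (quotientChannel K W x y / (1 / q * S)) -
      ((1 / q) * W x y * Real.log (W x y / (1 / q * S)) + (1 / q) * W x y * Real.log c) ≤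
      (quotientChannel H W x y * quotientChannel K W x y) * (1 / (S * c)) - (1 / q) * W x y := by
    intro x
    have hA := quotientChannel_nonneg H h.1 x y
    have hB := quotientChannel_nonneg K h.1 x y
    obtain h0 | hpos := (h.1 x y).eq_or_lt
    · rw [← h0]
      simp only [mul_zero, zero_mul, add_zero, sub_zero]
      positivity
    · have hA := quotientChannel_mk_pos H h.1 hpos
      have hB := quotientChannel_mk_pos K h.1 hpos
      have hSpos : 0 < S := hpos.trans_le
        (Finset.single_le_sum (f := fun x => W x y) (fun x _ => h.1 x y) (Finset.mem_univ x))
      generalize quotientChannel H W x y = A at *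
      generalize quotientChannel K W x y = B at *
      generalize W x y = w at *
      have hle := Real.log_le_sub_one_of_pos (x := A * B * q / (S * w * c)) (by positivity)
      have heq : Real.log (A * B * q / (S * w * c)) = Real.log (A / (1 / q * S)) +
          Real.log (B / (1 / q * S)) - (Real.log (w / (1 / q * S)) + Real.log c) := by
        rw [← Real.log_mul (by positivity) (by positivity),
          ← Real.log_mul (by positivity) (by positivity),
          ← Real.log_div (by positivity) (by positivity)]
        congr 1
        field_simp
      calc _ = (1 / q) * w * Real.log (A * B * q / (S * w * c)) := by rw [heq]; ring
        _ ≤ (1 / q) * w * (A * B * q / (S * w * c) - 1) := by gcongr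
        _ = _ := by field_simp
  refine (Finset.sum_le_sum fun x _ => hterm x).trans ?_
  rw [Finset.sum_sub_distrib, ← Finset.sum_mul, ← Finset.mul_sum, ← hS, sub_nonpos]
  obtain h0 | hSpos := hS0.eq_or_lt
  · simp [← h0]
  calc _ ≤ (Nat.card (H ⊓ K : AddSubgroup G) / (Nat.card H * Nat.card K) * S ^ 2) *
        (1 / (S * c)) := by
        gcongr
        exact sum_quotientChannel_mul_le H K h.1 y
    _ = _ := by rw [hc]; field_simp

theorem DeterminedBy.mono {G : Type*} [AddCommGroup G] [Fintype G] {Y : Type*} [Fintype Y]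
    {W : G → Y → ℝ} {H : AddSubgroup G} {δ δ' : ℝ} (h : DeterminedBy W H δ) (hδ : δ ≤ δ') :
    DeterminedBy W H δ' :=
  ⟨h.1.trans_le hδ, h.2.trans_le hδ⟩

theorem DeterminedBy.map_eq {G : Type*} [AddCommGroup G] [Fintype G] {Y : Type*} [Fintype Y]
    {W : G → Y → ℝ} (hW : IsChannel W) (hsym : IsAutSymmetric W) {H : AddSubgroup G} {δ : ℝ}
    (h : DeterminedBy W H δ) (hδ : 3 * δ ≤ Real.log 2) (f : G ≃+ G) :
    H.map f.toAddMonoidHom = H := by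
  set K := H.map f.toAddMonoidHom with hKdef
  have hcard : Nat.card K = Nat.card H :=
    (Nat.card_congr (H.equivMapOfInjective f.toAddMonoidHom f.injective).toEquiv).symm
  have hle := capacity_quotientChannel_add_le H K hW
  rw [hKdef, capacity_quotientChannel_map H f hsym, ← hKdef, hcard,
    ← H.natCard_quotient_mul_natCard] at hle
  have h1 := abs_lt.1 h.1
  have h2 := abs_lt.1 h.2
  have hH : 0 < (Nat.card H : ℝ) := mod_cast Nat.card_pos
  have hQ : 0 < (Nat.card (G ⧸ H) : ℝ) := mod_cast Nat.card_pos
  have hHK : 0 < (Nat.card (H ⊓ K : AddSubgroup G) : ℝ) := mod_cast Nat.card_pos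
  have heq : (Nat.card (G ⧸ H) * Nat.card H * Nat.card (H ⊓ K : AddSubgroup G) /
      (Nat.card H * Nat.card H) : ℝ) =
      Nat.card (G ⧸ H) * Nat.card (H ⊓ K : AddSubgroup G) / Nat.card H := by
    field_simp
  rw [heq, Real.log_div (by positivity) (by positivity),
    Real.log_mul (by positivity) (by positivity)] at hle
  have hlt : Real.log (Nat.card H) < Real.log (2 * Nat.card (H ⊓ K : AddSubgroup G)) := by
    rw [Real.log_mul (by norm_num) (by positivity)]
    linarith
  have hlt' : Nat.card H < 2 * Nat.card (H ⊓ K : AddSubgroup G) := by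
    exact_mod_cast (Real.log_lt_log_iff hH (by positivity)).1 hlt
  have hdvd : Nat.card (H ⊓ K : AddSubgroup G) ∣ Nat.card H :=
    AddSubgroup.card_dvd_of_le inf_le_left
  have hinf : Nat.card (H ⊓ K : AddSubgroup G) = Nat.card H := by
    obtain ⟨k, hk⟩ := hdvd
    have hpos : 0 < Nat.card H := Nat.card_pos
    have hk2 : k < 2 := by
      by_contra! hge
      nlinarith
    interval_cases k <;> omega
  have hHle : H ≤ K :=
    inf_eq_left.1 (AddSubgroup.eq_of_le_of_card_ge inf_le_left hinf.ge)
  exact (AddSubgroup.eq_of_le_of_card_ge hHle hcard.le).symm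

/-- if the only characteristic subgroups of `G` are `{0}` and `G`, then every
generalized `q`-symmetric channel (satisfying the background polarization property) strongly
polarizes. -/
theorem stmt_15 {G : Type u} [AddCommGroup G] [Fintype G]
    (htriv : ∀ H : AddSubgroup G,
      (∀ f : G ≃+ G, H.map f.toAddMonoidHom = H) → H = ⊥ ∨ H = ⊤)
    (C : Channel G) (hC : IsChannel C.prob) (hsym : IsGeneralizedSymmetric C.prob)
    (hbg : Polarizes C Set.univ) :
    ∀ δ > (0 : ℝ), Filter.Tendsto
      (fun n : ℕ => ((Finset.univ.filter (fun s : Fin n → Bool =>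
          DeterminedBy (C.polar (List.ofFn s)).prob (⊥ : AddSubgroup G) δ ∨
          DeterminedBy (C.polar (List.ofFn s)).prob (⊤ : AddSubgroup G) δ)).card : ℝ) / 2 ^ n)
      Filter.atTop (nhds 1) := by
  intro δ hδ
  have hlog : 0 < Real.log 2 := Real.log_pos (by norm_num)
  have hδ' : 0 < min δ (Real.log 2 / 3) := lt_min hδ (by positivity)
  refine tendsto_of_tendsto_of_tendsto_of_le_of_le (hbg _ hδ') tendsto_const_nhds
    (fun n => ?_) (fun n => ?_)
  · refine div_le_div_of_nonneg_right (Nat.cast_le.2 (Finset.card_le_card ?_)) (by positivity)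
    intro s hs
    simp only [Finset.mem_filter, Finset.mem_univ, true_and] at hs ⊢
    obtain ⟨H, -, hH⟩ := hs
    obtain ⟨hch, haut⟩ := Channel.polar_induction
      (P := fun C => IsChannel C.prob ∧ IsAutSymmetric C.prob)
      (fun C h => ⟨h.1.minusChannel, h.2.minusChannel⟩)
      (fun C h => ⟨h.1.plusChannel, h.2.plusChannel⟩) (List.ofFn s) C ⟨hC, hsym.isAutSymmetric⟩
    have hsmall : 3 * min δ (Real.log 2 / 3) ≤ Real.log 2 := by
      linarith [min_le_right δ (Real.log 2 / 3)]
    have hmono := hH.mono (min_le_left δ (Real.log 2 / 3))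
    obtain rfl | rfl := htriv H (hH.map_eq hch haut hsmall)
    · exact Or.inl hmono
    · exact Or.inr hmono
  · refine div_le_one_of_le₀ ?_ (by positivity)
    have hle := Finset.card_filter_le (Finset.univ : Finset (Fin n → Bool)) (fun s =>
      DeterminedBy (C.polar (List.ofFn s)).prob (⊥ : AddSubgroup G) δ ∨
      DeterminedBy (C.polar (List.ofFn s)).prob (⊤ : AddSubgroup G) δ)
    rw [Finset.card_univ, Fintype.card_fun, Fintype.card_bool, Fintype.card_fin] at hle
    exact (Nat.cast_le.2 hle).trans_eq (by push_cast; rfl)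

end
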